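/- Consider a dynamically nontrivial quadratic (n,m,n−1) mass action network (every row of A sums to at most 2, rank Γ = n−1) with n ≤ m ≤ n + p_f − 1, where p_f is the size of the fundamental partition. Then: (i) if rank [A | 1] ≤ n (the source rank is less than n), then for every κ ∈ ℝ^m_+ and K ∈ ℝ, the set of nondegenerate equilibria in E_κ ∩ S_K has at most 2 elements; (ii) if the all-ones vector lies in the image of A (i.e. there is z ∈ ℝ^n with Az the all-ones vector) and there exists ω ∈ ker Γ^⊤ ∩ ℝ^n_{≥0} \ {0}, then this set has at most 1 element. -/

import Mathlib

open Matrix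

noncomputable section

/-- Entrywise power of a vector by a real exponent matrix:
`(powVec M x) i = ∏ j, (x j) ^ (M i j)` (real powers). -/
def powVec {k l : ℕ} (M : Matrix (Fin k) (Fin l) ℝ) (x : Fin l → ℝ) : Fin k → ℝ :=
  fun i => ∏ j, x j ^ M i j

/-- Cast an integer matrix to a real matrix. -/
def mR {a b : ℕ} (M : Matrix (Fin a) (Fin b) ℤ) : Matrix (Fin a) (Fin b) ℝ :=
  M.map fun t => (t : ℝ)

/-- The (open) positive orthant. -/
def posOrth (k : ℕ) : Set (Fin k → ℝ) :=
  {x | ∀ i, 0 < x i}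

/-- The mass action vector field `g_κ(x) = Γ (κ ∘ x^A)`. -/
def massAction {n m : ℕ} (Γ : Matrix (Fin n) (Fin m) ℤ) (A : Matrix (Fin m) (Fin n) ℤ)
    (κ : Fin m → ℝ) (x : Fin n → ℝ) : Fin n → ℝ :=
  (mR Γ).mulVec (κ * powVec (mR A) x)

/-- The positive equilibrium set `E_κ`. -/
def Eset {n m : ℕ} (Γ : Matrix (Fin n) (Fin m) ℤ) (A : Matrix (Fin m) (Fin n) ℤ)
    (κ : Fin m → ℝ) : Set (Fin n → ℝ) :=
  {x | (∀ i, 0 < x i) ∧ massAction Γ A κ x = 0}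

/-- The Jacobian matrix `Γ D_{κ∘x^A} A D_{1/x}` of `g_κ` at `x`. -/
def jacMat {n m : ℕ} (Γ : Matrix (Fin n) (Fin m) ℤ) (A : Matrix (Fin m) (Fin n) ℤ)
    (κ : Fin m → ℝ) (x : Fin n → ℝ) : Matrix (Fin n) (Fin n) ℝ :=
  mR Γ * Matrix.diagonal (κ * powVec (mR A) x) * mR A * Matrix.diagonal (fun i => (x i)⁻¹)

/-- Nondegeneracy of an equilibrium: `ker J_{g_κ}(x) ∩ im Γ = {0}`. -/
def nondegAt {n m : ℕ} (Γ : Matrix (Fin n) (Fin m) ℤ) (A : Matrix (Fin m) (Fin n) ℤ)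
    (κ : Fin m → ℝ) (x : Fin n → ℝ) : Prop :=
  ∀ z : Fin n → ℝ, (jacMat Γ A κ x).mulVec z = 0 → (∃ v, (mR Γ).mulVec v = z) → z = 0

/-- Strong degeneracy of the network: every positive equilibrium has Jacobian of
rank less than `rank Γ`, for every choice of rate constants. -/
def stronglyDegenerate {n m : ℕ} (Γ : Matrix (Fin n) (Fin m) ℤ)
    (A : Matrix (Fin m) (Fin n) ℤ) : Prop :=
  ∀ κ ∈ posOrth m, ∀ x ∈ Eset Γ A κ, (jacMat Γ A κ x).rank < (mR Γ).rank

/-- Dynamically nontrivial: the positive flux cone `ker Γ ∩ ℝ^m_+` is nonempty. -/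
def dynNontrivial {n m : ℕ} (Γ : Matrix (Fin n) (Fin m) ℤ) : Prop :=
  ∃ v : Fin m → ℝ, (mR Γ).mulVec v = 0 ∧ ∀ j, 0 < v j

/-- `ker Γ` factors over the partition of `{1,…,m}` given by the fibres of `blk`. -/
def factorsOver {n m p : ℕ} (Γ : Matrix (Fin n) (Fin m) ℤ) (blk : Fin m → Fin p) : Prop :=
  ∀ v : Fin m → ℝ, (mR Γ).mulVec v = 0 →
    ∀ i : Fin p, (mR Γ).mulVec (fun j => if blk j = i then v j else 0) = 0

/-- The matrix `[A | 1_P]`. -/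
def srcMat {n m p : ℕ} (A : Matrix (Fin m) (Fin n) ℤ) (blk : Fin m → Fin p) :
    Matrix (Fin m) (Fin (n + p)) ℝ :=
  Matrix.of fun j => Fin.append (fun k => (A j k : ℝ)) (fun i => if blk j = i then 1 else 0)

/-- The first `n` rows of an `(n+p)×k` matrix. -/
def topRows (n p : ℕ) {k : ℕ} (M : Matrix (Fin (n + p)) (Fin k) ℝ) :
    Matrix (Fin n) (Fin k) ℝ :=
  Matrix.of fun i j => M (Fin.castAdd p i) j

/-- The flux-cone parameterisation `(1_P λ) ∘ h(α)`. -/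
def fluxParam {m p d : ℕ} (blk : Fin m → Fin p) (h : (Fin d → ℝ) → (Fin m → ℝ))
    (lam : Fin p → ℝ) (α : Fin d → ℝ) : Fin m → ℝ :=
  fun j => lam (blk j) * h α j

/-- Admissible cross-section parameterisation of the positive flux cone:
`Y` is an open bounded convex set (an open polytope), `h` is affine and injective,
depends blockwise on the coordinates of `Y`, and `(λ, α) ↦ (1_P λ) ∘ h(α)` is a
bijection from `ℝ^p_+ × Y` onto the positive flux cone. -/
def admissibleH {n m p d : ℕ} (Γ : Matrix (Fin n) (Fin m) ℤ) (blk : Fin m → Fin p)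
    (Y : Set (Fin d → ℝ)) (h : (Fin d → ℝ) → (Fin m → ℝ)) : Prop :=
  IsOpen Y ∧ Convex ℝ Y ∧ Bornology.IsBounded Y ∧ Y.Nonempty ∧
  (∃ (L : (Fin d → ℝ) →ₗ[ℝ] (Fin m → ℝ)) (c : Fin m → ℝ), ∀ α, h α = L α + c) ∧
  (∃ bY : Fin d → Fin p, ∀ (α α' : Fin d → ℝ) (j : Fin m),
      (∀ t, bY t = blk j → α t = α' t) → h α j = h α' j) ∧
  (∀ (lam : Fin p → ℝ) (α : Fin d → ℝ), (∀ i, 0 < lam i) → α ∈ Y →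
      (mR Γ).mulVec (fluxParam blk h lam α) = 0 ∧ ∀ j, 0 < fluxParam blk h lam α j) ∧
  (∀ v : Fin m → ℝ, (mR Γ).mulVec v = 0 → (∀ j, 0 < v j) →
      ∃ (lam : Fin p → ℝ) (α : Fin d → ℝ), (∀ i, 0 < lam i) ∧ α ∈ Y ∧
        v = fluxParam blk h lam α) ∧
  (∀ (lam lam' : Fin p → ℝ) (α α' : Fin d → ℝ), (∀ i, 0 < lam i) → (∀ i, 0 < lam' i) →
      α ∈ Y → α' ∈ Y → fluxParam blk h lam α = fluxParam blk h lam' α' →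
      lam = lam' ∧ α = α')

/-- The solvability variety `A_κ = {α ∈ Y : h(α)^W = κ^W}`. -/
def Aset {m d w : ℕ} (W : Matrix (Fin w) (Fin m) ℝ) (Y : Set (Fin d → ℝ))
    (h : (Fin d → ℝ) → (Fin m → ℝ)) (κ : Fin m → ℝ) : Set (Fin d → ℝ) :=
  {α ∈ Y | powVec W (h α) = powVec W κ}

/-- The rows of `W` form a basis of `ker [A|1_P]ᵀ`. -/
def isSolvabilityMatrix {n m p w : ℕ} (A : Matrix (Fin m) (Fin n) ℤ) (blk : Fin m → Fin p)
    (W : Matrix (Fin w) (Fin m) ℝ) : Prop :=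
  W * srcMat A blk = 0 ∧ W.rank = w ∧ w + (srcMat A blk).rank = m

/-- The columns of `Q` form a basis of `ker [A|1_P]`. -/
def isKernelMatrix {n m p q : ℕ} (A : Matrix (Fin m) (Fin n) ℤ) (blk : Fin m → Fin p)
    (Q : Matrix (Fin (n + p)) (Fin q) ℝ) : Prop :=
  srcMat A blk * Q = 0 ∧ Q.rank = q ∧ (srcMat A blk).rank + q = n + p

/-- `G` is a generalised inverse of `[A|1_P]`. -/
def isGenInv {n m p : ℕ} (A : Matrix (Fin m) (Fin n) ℤ) (blk : Fin m → Fin p)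
    (G : Matrix (Fin (n + p)) (Fin m) ℝ) : Prop :=
  srcMat A blk * G * srcMat A blk = srcMat A blk

/-- The parameterising map `F_κ(α,μ) = (h(α)/κ)^Ĝ ∘ μ^Q̂`. -/
def Fmap {n m p d q : ℕ} (G : Matrix (Fin (n + p)) (Fin m) ℝ)
    (Q : Matrix (Fin (n + p)) (Fin q) ℝ)
    (h : (Fin d → ℝ) → (Fin m → ℝ)) (κ : Fin m → ℝ) :
    (Fin d → ℝ) × (Fin q → ℝ) → (Fin n → ℝ) :=
  fun z => powVec (topRows n p G) (h z.1 / κ) * powVec (topRows n p Q) z.2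



lemma aux_im {n m : ℕ} (G : Matrix (Fin n) (Fin m) ℝ) (hrank : G.rank + 1 = n)
    (z : Fin n → ℝ) (hz : Matrix.vecMul z G = 0) (hz0 : z ≠ 0) (u : Fin n → ℝ)
    (hu : z ⬝ᵥ u = 0) : ∃ v, G.mulVec v = u := by
  have hle : LinearMap.range G.mulVecLin ≤ LinearMap.ker (dotProductBilin ℝ ℝ z) := by
    rintro _ ⟨v, rfl⟩
    simp [dotProduct_mulVec, hz]
  have hne : (dotProductBilin ℝ ℝ z : Module.Dual ℝ (Fin n → ℝ)) ≠ 0 := by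
    intro h
    apply hz0
    have := LinearMap.congr_fun h z
    simpa using this
  have hf := Module.Dual.finrank_ker_add_one_of_ne_zero hne
  have heq : LinearMap.range G.mulVecLin = LinearMap.ker (dotProductBilin ℝ ℝ z) := by
    apply Submodule.eq_of_le_of_finrank_le hle
    have : G.rank = Module.finrank ℝ (LinearMap.range G.mulVecLin) := rfl
    simp at hf
    omega
  have hm : u ∈ LinearMap.ker (dotProductBilin ℝ ℝ z) := by simpa using hu
  rw [← heq] at hm
  obtain ⟨v, hv⟩ := hm
  exact ⟨v, by simpa using hv⟩

lemma aux_ker {n m p : ℕ} (Γ : Matrix (Fin n) (Fin m) ℤ) (hrank : (mR Γ).rank + 1 = n)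
    (blk : Fin m → Fin p) (hblk : Function.Surjective blk) (hfac : factorsOver Γ blk)
    (hm2 : m + 1 ≤ n + p) (v : Fin m → ℝ) (hv : (mR Γ).mulVec v = 0) (hvp : ∀ j, 0 < v j)
    (u : Fin m → ℝ) (hu : (mR Γ).mulVec u = 0) :
    ∃ μ : Fin p → ℝ, ∀ j, u j = μ (blk j) * v j := by
  let L : (Fin p → ℝ) →ₗ[ℝ] (Fin m → ℝ) :=
    { toFun := fun μ j => μ (blk j) * v j
      map_add' := by intro a b; ext j; simp [add_mul]
      map_smul' := by intro a b; ext j; simp [mul_assoc] }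
  have hinj : Function.Injective L := by
    intro a b hab
    ext i
    obtain ⟨j, rfl⟩ := hblk i
    have : a (blk j) * v j = b (blk j) * v j := congrFun hab j
    exact mul_right_cancel₀ (hvp j).ne' this
  have hle : LinearMap.range L ≤ LinearMap.ker (mR Γ).mulVecLin := by
    rintro _ ⟨μ, rfl⟩
    have : L μ = ∑ i, μ i • (fun j => if blk j = i then v j else 0) := by
      ext j
      simp [L, Finset.sum_apply]
    rw [this]
    apply Submodule.sum_mem
    intro i _
    apply Submodule.smul_mem
    simpa using hfac v hv i
  have h1 := LinearMap.finrank_range_of_inj hinj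
  have h2 := LinearMap.finrank_range_add_finrank_ker (mR Γ).mulVecLin
  have heq : LinearMap.range L = LinearMap.ker (mR Γ).mulVecLin := by
    apply Submodule.eq_of_le_of_finrank_le hle
    have : (mR Γ).rank = Module.finrank ℝ (LinearMap.range (mR Γ).mulVecLin) := rfl
    simp at h1 h2
    omega
  have hm : u ∈ LinearMap.ker (mR Γ).mulVecLin := by simpa using hu
  rw [← heq] at hm
  obtain ⟨μ, rfl⟩ := hm
  exact ⟨μ, fun j => rfl⟩

lemma aux_fac {n m p : ℕ} (Γ : Matrix (Fin n) (Fin m) ℤ)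
    (blk : Fin m → Fin p) (hfac : factorsOver Γ blk)
    (v : Fin m → ℝ) (hv : (mR Γ).mulVec v = 0) (μ : Fin p → ℝ) :
    (mR Γ).mulVec (fun j => v j * μ (blk j)) = 0 := by
  have : (fun j => v j * μ (blk j)) = ∑ i, μ i • (fun j => if blk j = i then v j else 0) := by
    ext j
    simp [Finset.sum_apply, mul_comm]
  rw [this]
  change (mR Γ).mulVecLin _ = 0
  rw [map_sum]
  apply Finset.sum_eq_zero
  intro i _
  rw [map_smul]
  have h0 : (mR Γ).mulVecLin (fun j => if blk j = i then v j else 0) = 0 := hfac v hv i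
  rw [h0, smul_zero]

lemma aux_powpos {m n : ℕ} (M : Matrix (Fin m) (Fin n) ℝ) (x : Fin n → ℝ) (hx : ∀ i, 0 < x i)
    (i : Fin m) : 0 < powVec M x i :=
  Finset.prod_pos fun j _ => Real.rpow_pos_of_pos (hx j) _

lemma aux_powlog {m n : ℕ} (M : Matrix (Fin m) (Fin n) ℝ) (x : Fin n → ℝ) (hx : ∀ i, 0 < x i)
    (i : Fin m) : Real.log (powVec M x i) = ∑ j, M i j * Real.log (x j) := by
  unfold powVec
  rw [Real.log_prod (fun j _ => (Real.rpow_pos_of_pos (hx j) _).ne')]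
  exact Finset.sum_congr rfl fun j _ => Real.log_rpow (hx j) _

lemma aux_diff {n m p : ℕ} (Γ : Matrix (Fin n) (Fin m) ℤ) (A : Matrix (Fin m) (Fin n) ℤ)
    (hdyn : dynNontrivial Γ) (hrank : (mR Γ).rank + 1 = n)
    (blk : Fin m → Fin p) (hblk : Function.Surjective blk) (hfac : factorsOver Γ blk)
    (hm2 : m + 1 ≤ n + p) (κ : Fin m → ℝ) (hκ : κ ∈ posOrth m) (x y : Fin n → ℝ)
    (hx : x ∈ Eset Γ A κ) (hy : y ∈ Eset Γ A κ) :
    ∃ μ : Fin p → ℝ, (mR A).mulVec (fun j => Real.log (y j) - Real.log (x j)) =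
      fun i => μ (blk i) := by
  obtain ⟨v, hv, hvp⟩ := hdyn
  obtain ⟨a, ha⟩ := aux_ker Γ hrank blk hblk hfac hm2 v hv hvp _ hx.2
  obtain ⟨b, hb⟩ := aux_ker Γ hrank blk hblk hfac hm2 v hv hvp _ hy.2
  refine ⟨fun i => Real.log (b i) - Real.log (a i), ?_⟩
  ext i
  have key : ∀ (y : Fin n → ℝ) (b : Fin p → ℝ), (∀ i, 0 < y i) →
      (∀ j, (κ * powVec (mR A) y) j = b (blk j) * v j) →
      Real.log (b (blk i)) = Real.log (κ i) + (∑ j, mR A i j * Real.log (y j))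
        - Real.log (v i) := by
    intro y b hy hb
    have h := hb i
    have hp := aux_powpos (mR A) y hy i
    have hk : 0 < κ i := hκ i
    have hbp : 0 < b (blk i) := by
      have : 0 < b (blk i) * v i := by rw [← h]; exact mul_pos hk hp
      exact (pos_iff_pos_of_mul_pos this).2 (hvp i)
    rw [← aux_powlog _ _ hy, ← Real.log_mul hk.ne' hp.ne']
    have h' : κ i * powVec (mR A) y i = b (blk i) * v i := h
    rw [h', Real.log_mul hbp.ne' (hvp i).ne']
    ring
  simp only [key x a hx.1 ha, key y b hy.1 hb, mulVec, dotProduct, mul_sub,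
    Finset.sum_sub_distrib]
  ring

lemma aux_jac {n m p : ℕ} (Γ : Matrix (Fin n) (Fin m) ℤ) (A : Matrix (Fin m) (Fin n) ℤ)
    (blk : Fin m → Fin p) (hfac : factorsOver Γ blk) (κ : Fin m → ℝ) (x : Fin n → ℝ)
    (hx : x ∈ Eset Γ A κ) (u : Fin n → ℝ) (μ : Fin p → ℝ)
    (hu : (mR A).mulVec u = fun i => μ (blk i)) :
    (jacMat Γ A κ x).mulVec (x * u) = 0 := by
  unfold jacMat
  rw [← mulVec_mulVec, ← mulVec_mulVec, ← mulVec_mulVec]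
  have h1 : (Matrix.diagonal (fun i => (x i)⁻¹)).mulVec (x * u) = u := by
    ext j
    rw [mulVec_diagonal]
    have := (hx.1 j).ne'
    simp only [Pi.mul_apply]
    field_simp
  rw [h1, hu]
  have h2 : (Matrix.diagonal (κ * powVec (mR A) x)).mulVec (fun i => μ (blk i)) =
      fun j => (κ * powVec (mR A) x) j * μ (blk j) := by
    ext j
    rw [mulVec_diagonal]
  rw [h2]
  exact aux_fac Γ blk hfac _ hx.2 μ

/-- at a nondegenerate equilibrium, nonzero log-directions are transversal -/
lemma aux_trans {n m p : ℕ} (Γ : Matrix (Fin n) (Fin m) ℤ) (A : Matrix (Fin m) (Fin n) ℤ)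
    (hrank : (mR Γ).rank + 1 = n)
    (blk : Fin m → Fin p) (hfac : factorsOver Γ blk)
    (z : Fin n → ℝ) (hz : Matrix.vecMul z (mR Γ) = 0) (hz0 : z ≠ 0)
    (κ : Fin m → ℝ) (x : Fin n → ℝ)
    (hx : x ∈ Eset Γ A κ) (hnd : nondegAt Γ A κ x) (u : Fin n → ℝ) (μ : Fin p → ℝ)
    (hu : (mR A).mulVec u = fun i => μ (blk i)) (h0 : z ⬝ᵥ (x * u) = 0) : u = 0 := by
  have h := hnd _ (aux_jac Γ A blk hfac κ x hx u μ hu) (aux_im _ hrank z hz hz0 _ h0)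
  ext j
  have hj := congrFun h j
  simpa [(hx.1 j).ne'] using hj

lemma aux_span {n m p : ℕ} (Γ : Matrix (Fin n) (Fin m) ℤ) (A : Matrix (Fin m) (Fin n) ℤ)
    (hrank : (mR Γ).rank + 1 = n)
    (blk : Fin m → Fin p) (hfac : factorsOver Γ blk)
    (z : Fin n → ℝ) (hz : Matrix.vecMul z (mR Γ) = 0) (hz0 : z ≠ 0)
    (κ : Fin m → ℝ) (x : Fin n → ℝ)
    (hx : x ∈ Eset Γ A κ) (hnd : nondegAt Γ A κ x) (w : Fin n → ℝ) (c : ℝ) (hw0 : w ≠ 0)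
    (hw : (mR A).mulVec w = fun _ => c) (u : Fin n → ℝ) (μ : Fin p → ℝ)
    (hu : (mR A).mulVec u = fun i => μ (blk i)) : ∃ s : ℝ, u = s • w := by
  have hne : z ⬝ᵥ (x * w) ≠ 0 := fun h =>
    hw0 (aux_trans Γ A hrank blk hfac z hz hz0 κ x hx hnd w (fun _ => c) hw h)
  refine ⟨(z ⬝ᵥ (x * u)) / (z ⬝ᵥ (x * w)), ?_⟩
  rw [← sub_eq_zero]
  apply aux_trans Γ A hrank blk hfac z hz hz0 κ x hx hnd _
    (fun i => μ i - (z ⬝ᵥ (x * u)) / (z ⬝ᵥ (x * w)) * c)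
  · rw [mulVec_sub, mulVec_smul, hu, hw]
    ext i
    simp
  · rw [mul_sub, mul_smul_comm, dotProduct_sub, dotProduct_smul, smul_eq_mul]
    field_simp
    ring

lemma aux_split {n : ℕ} (b : Fin n → ℤ) (hb : ∀ j, 0 ≤ b j) :
    b = 0 ∨ ∃ (i : Fin n) (b' : Fin n → ℤ), b = Pi.single i 1 + b' ∧ (∀ j, 0 ≤ b' j) ∧ ∑ j, b' j = ∑ j, b j - 1 := by
  by_cases h : b = 0
  · exact Or.inl h
  · right
    obtain ⟨i, hi⟩ := Function.ne_iff.1 h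
    refine ⟨i, b - Pi.single i 1, by simp, ?_, by simp [Finset.sum_sub_distrib]⟩
    intro j
    by_cases hj : j = i
    · subst hj
      have := hb j
      simp at hi ⊢
      omega
    · simpa [hj] using hb j

lemma aux_zero {n : ℕ} (b : Fin n → ℤ) (hb : ∀ j, 0 ≤ b j) (hs : ∑ j, b j ≤ 0) : b = 0 := by
  ext i
  have := Finset.single_le_sum (fun j _ => hb j) (Finset.mem_univ i)
  have := hb i
  simp
  omega

lemma aux_row {n : ℕ} (b : Fin n → ℤ) (hb : ∀ j, 0 ≤ b j) (hs : ∑ j, b j ≤ 2)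
    (w : Fin n → ℝ) (c : ℝ) (hw : ∑ j, (b j : ℝ) * w j = c) :
    ∑ j, (b j : ℝ) * (w j * (w j - c) * (2 * w j - c)) = 0 := by
  rcases aux_split b hb with rfl | ⟨i, b', rfl, hb', hs'⟩
  · simp
  rcases aux_split b' hb' with rfl | ⟨k, b'', rfl, hb'', hs''⟩
  · have hw' : w i = c := by
      rw [← hw]; simp [Pi.single_apply]
    simp [Pi.single_apply, hw']
  · obtain rfl := aux_zero b'' hb'' (by omega)
    have hw' : w i + w k = c := by
      rw [← hw]; simp [Pi.single_apply, add_mul, Finset.sum_add_distrib]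
    simp [Pi.single_apply, add_mul, Finset.sum_add_distrib]
    rw [← hw']
    ring

lemma aux_vals {n m p : ℕ} (Γ : Matrix (Fin n) (Fin m) ℤ) (A : Matrix (Fin m) (Fin n) ℤ)
    (hA : ∀ i j, 0 ≤ A i j) (hquad : ∀ i, ∑ j, A i j ≤ 2)
    (hrank : (mR Γ).rank + 1 = n) (hm1 : n ≤ m)
    (blk : Fin m → Fin p) (hfac : factorsOver Γ blk)
    (z : Fin n → ℝ) (hz : Matrix.vecMul z (mR Γ) = 0) (hz0 : z ≠ 0)
    (κ : Fin m → ℝ) (x : Fin n → ℝ)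
    (hx : x ∈ Eset Γ A κ) (hnd : nondegAt Γ A κ x) (w : Fin n → ℝ) (c : ℝ) (hw0 : w ≠ 0)
    (hw : (mR A).mulVec w = fun _ => c) :
    ∃ s : ℝ, s * c = 0 ∧ ∀ j, w j * (w j - c) * (2 * w j - c) = s * w j := by
  have h0 : (mR A).mulVec (fun j => w j * (w j - c) * (2 * w j - c)) = 0 := by
    ext i
    exact aux_row (A i) (hA i) (hquad i) w c (congrFun hw i)
  obtain ⟨s, hs⟩ := aux_span Γ A hrank blk hfac z hz hz0 κ x hx hnd w c hw0 hw _ (fun _ => 0)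
    (by rw [h0]; rfl)
  refine ⟨s, ?_, fun j => congrFun hs j⟩
  rw [hs, mulVec_smul, hw] at h0
  have := congrFun h0 ⟨0, by omega⟩
  simpa using this

lemma aux_curve {n m p : ℕ} (Γ : Matrix (Fin n) (Fin m) ℤ) (A : Matrix (Fin m) (Fin n) ℤ)
    (hdyn : dynNontrivial Γ) (hrank : (mR Γ).rank + 1 = n)
    (blk : Fin m → Fin p) (hblk : Function.Surjective blk) (hfac : factorsOver Γ blk)
    (hm2 : m + 1 ≤ n + p)
    (z : Fin n → ℝ) (hz : Matrix.vecMul z (mR Γ) = 0) (hz0 : z ≠ 0)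
    (κ : Fin m → ℝ) (hκ : κ ∈ posOrth m) (x : Fin n → ℝ)
    (hx : x ∈ Eset Γ A κ) (hnd : nondegAt Γ A κ x) (w : Fin n → ℝ) (c : ℝ) (hw0 : w ≠ 0)
    (hw : (mR A).mulVec w = fun _ => c) (y : Fin n → ℝ) (hy : y ∈ Eset Γ A κ) :
    ∃ t : ℝ, y = fun j => x j * Real.exp (t * w j) := by
  obtain ⟨μ, hμ⟩ := aux_diff Γ A hdyn hrank blk hblk hfac hm2 κ hκ x y hx hy
  obtain ⟨t, ht⟩ := aux_span Γ A hrank blk hfac z hz hz0 κ x hx hnd w c hw0 hw _ μ hμ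
  refine ⟨t, ?_⟩
  ext j
  have h : Real.log (y j) - Real.log (x j) = t * w j := congrFun ht j
  rw [← h, Real.exp_sub, Real.exp_log (hx.1 j), Real.exp_log (hy.1 j)]
  have := (hx.1 j).ne'
  field_simp

lemma aux_quad (P Q R q r : ℝ) (hq : q ≠ 1) (hr : r ≠ 1) (hqr : q ≠ r)
    (h1 : P + Q + R = 0) (h2 : P + Q * q + R * q ^ 2 = 0) (h3 : P + Q * r + R * r ^ 2 = 0) :
    P = 0 ∧ Q = 0 ∧ R = 0 := by
  have e1 : Q + R * (q + 1) = 0 := by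
    apply mul_left_cancel₀ (sub_ne_zero.2 hq); linear_combination h2 - h1
  have e2 : Q + R * (r + 1) = 0 := by
    apply mul_left_cancel₀ (sub_ne_zero.2 hr); linear_combination h3 - h1
  have e3 : R = 0 := by
    apply mul_left_cancel₀ (sub_ne_zero.2 hqr); linear_combination e1 - e2
  subst e3
  have e4 : Q = 0 := by linarith
  exact ⟨by linarith, e4, rfl⟩

lemma aux_exp3 {n : ℕ} (g w : Fin n → ℝ) (a b : ℝ) (ha : a ≠ 0) (hb : b = 0 ∨ b = -a)
    (hw : ∀ j, w j = b ∨ w j = b + a ∨ w j = b + 2 * a) (t s : ℝ) (ht : t ≠ 0) (hs : s ≠ 0)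
    (hts : t ≠ s) (h1 : ∑ j, g j * Real.exp (t * w j) = ∑ j, g j)
    (h2 : ∑ j, g j * Real.exp (s * w j) = ∑ j, g j) : ∑ j, g j * w j = 0 := by
  classical
  have hind : ∀ j, ∃ P Q R : ℝ, P + Q + R = 1 ∧ w j = b * P + (b + a) * Q + (b + 2 * a) * R ∧
      ∀ t, Real.exp (t * w j) = Real.exp (t * b) *
        (P + Q * Real.exp (t * a) + R * Real.exp (t * a) ^ 2) := by
    intro j
    rcases hw j with h | h | h
    · exact ⟨1, 0, 0, by ring, by rw [h]; ring, fun t => by rw [h]; ring⟩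
    · exact ⟨0, 1, 0, by ring, by rw [h]; ring, fun t => by
        rw [h, mul_add, Real.exp_add]; ring⟩
    · exact ⟨0, 0, 1, by ring, by rw [h]; ring, fun t => by
        rw [h, mul_add, Real.exp_add, mul_left_comm, two_mul, Real.exp_add]; ring⟩
  choose P Q R hone hlin hexp using hind
  have hsum : ∑ j, g j = ∑ j, g j * P j + ∑ j, g j * Q j + ∑ j, g j * R j := by
    rw [← Finset.sum_add_distrib, ← Finset.sum_add_distrib]
    exact Finset.sum_congr rfl fun j _ => by linear_combination (- g j) * hone j
  have hsl : ∑ j, g j * w j =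
      b * ∑ j, g j * P j + (b + a) * ∑ j, g j * Q j + (b + 2 * a) * ∑ j, g j * R j := by
    rw [Finset.mul_sum, Finset.mul_sum, Finset.mul_sum,
      ← Finset.sum_add_distrib, ← Finset.sum_add_distrib]
    exact Finset.sum_congr rfl fun j _ => by linear_combination (g j) * hlin j
  have hse : ∀ t, ∑ j, g j * Real.exp (t * w j) = Real.exp (t * b) *
      (∑ j, g j * P j + (∑ j, g j * Q j) * Real.exp (t * a)
        + (∑ j, g j * R j) * Real.exp (t * a) ^ 2) := by
    intro t
    rw [Finset.sum_mul, Finset.sum_mul,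
      ← Finset.sum_add_distrib, ← Finset.sum_add_distrib, Finset.mul_sum]
    exact Finset.sum_congr rfl fun j _ => by linear_combination (g j) * hexp j t
  rw [hse, hsum] at h1 h2
  rw [hsl]
  generalize ∑ j, g j * P j = p at *
  generalize ∑ j, g j * Q j = q at *
  generalize ∑ j, g j * R j = r at *
  have n1 : Real.exp (t * a) ≠ 1 := by simp [Real.exp_eq_one_iff, ht, ha]
  have n2 : Real.exp (s * a) ≠ 1 := by simp [Real.exp_eq_one_iff, hs, ha]
  have n3 : Real.exp (t * a) ≠ Real.exp (s * a) := by
    intro h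
    exact hts (mul_right_cancel₀ ha (Real.exp_injective h))
  rcases hb with rfl | rfl
  · simp only [mul_zero, Real.exp_zero, one_mul] at h1 h2
    obtain ⟨-, e2, e3⟩ := aux_quad (-q - r) q r _ _ n1 n2 n3 (by ring)
      (by linear_combination h1) (by linear_combination h2)
    rw [e2, e3]; ring
  · have k : ∀ t, Real.exp (t * a) * Real.exp (t * -a) = 1 := by
      intro t
      rw [← Real.exp_add]; simp
    obtain ⟨e1, -, e3⟩ := aux_quad p (- p - r) r _ _ n1 n2 n3 (by ring)
      (by linear_combination Real.exp (t * a) * h1 -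
            (p + q * Real.exp (t * a) + r * Real.exp (t * a) ^ 2) * k t)
      (by linear_combination Real.exp (s * a) * h2 -
            (p + q * Real.exp (s * a) + r * Real.exp (s * a) ^ 2) * k s)
    rw [e1, e3]; ring

lemma aux_ab {n : ℕ} (w : Fin n → ℝ) (hw0 : w ≠ 0) (c s : ℝ) (hsc : s * c = 0)
    (h : ∀ j, w j * (w j - c) * (2 * w j - c) = s * w j) :
    ∃ a b : ℝ, a ≠ 0 ∧ (b = 0 ∨ b = -a) ∧
      ∀ j, w j = b ∨ w j = b + a ∨ w j = b + 2 * a := by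
  rcases eq_or_ne c 0 with rfl | hc
  · obtain ⟨i, hi⟩ := Function.ne_iff.1 hw0
    simp only [Pi.zero_apply] at hi
    refine ⟨w i, -w i, hi, Or.inr rfl, ?_⟩
    have hi2 : 2 * w i ^ 2 = s := by
      apply mul_right_cancel₀ hi; linear_combination h i
    intro j
    have hj := h j
    rw [← hi2] at hj
    have : w j * ((w j - w i) * (w j + w i)) = 0 := by linear_combination hj / 2
    rcases mul_eq_zero.1 this with h | h
    · right; left; rw [h]; ring
    · rcases mul_eq_zero.1 h with h | h
      · right; right; linarith
      · left; linarith
  · obtain rfl : s = 0 := by simpa [hc] using hsc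
    refine ⟨c / 2, 0, by simpa using hc, Or.inl rfl, ?_⟩
    intro j
    have hj := h j
    rw [zero_mul] at hj
    rcases mul_eq_zero.1 hj with h | h
    · rcases mul_eq_zero.1 h with h | h
      · left; exact h
      · right; right; linarith
    · right; left; linarith

lemma aux_srcker {n m : ℕ} (hm : 0 < m) (A : Matrix (Fin m) (Fin n) ℤ)
    (h : (Matrix.of fun i : Fin m => Fin.snoc (fun j => (A i j : ℝ)) 1 :
        Matrix (Fin m) (Fin (n + 1)) ℝ).rank ≤ n) :
    ∃ (w : Fin n → ℝ) (c : ℝ), w ≠ 0 ∧ (mR A).mulVec w = fun _ => c := by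
  set M : Matrix (Fin m) (Fin (n + 1)) ℝ :=
    (Matrix.of fun i : Fin m => Fin.snoc (fun j => (A i j : ℝ)) 1) with hM
  have h2 := LinearMap.finrank_range_add_finrank_ker M.mulVecLin
  have : M.rank = Module.finrank ℝ (LinearMap.range M.mulVecLin) := rfl
  simp only [Module.finrank_fintype_fun_eq_card, Fintype.card_fin] at h2
  have hpos : LinearMap.ker M.mulVecLin ≠ ⊥ := by
    intro hb
    rw [hb, finrank_bot] at h2
    omega
  obtain ⟨u, hu, hu0⟩ := Submodule.exists_mem_ne_zero_of_ne_bot hpos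
  have hu' : M.mulVec u = 0 := by simpa using hu
  have hrow : ∀ i, ∑ j, (A i j : ℝ) * u (Fin.castSucc j) + u (Fin.last n) = 0 := by
    intro i
    have := congrFun hu' i
    simpa [hM, mulVec, dotProduct, Fin.sum_univ_castSucc] using this
  refine ⟨fun j => u (Fin.castSucc j), - u (Fin.last n), ?_, ?_⟩
  · intro h0
    apply hu0
    have h0' : ∀ j, u (Fin.castSucc j) = 0 := fun j => congrFun h0 j
    ext k
    refine Fin.lastCases ?_ (fun j => h0' j) k
    simpa [h0'] using hrow ⟨0, hm⟩
  · ext i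
    have := hrow i
    simp only [mulVec, dotProduct, mR, Matrix.map_apply]
    linarith

/-- Theorem `thmquadnnn1`: for a dynamically nontrivial quadratic
`(n,m,n−1)` network with `n ≤ m ≤ n + p_f − 1`:
(i) if `rank [A|1] ≤ n` then each stoichiometric class contains at most `2`
nondegenerate positive equilibria; (ii) if the all-ones vector lies in `im A` and
`ker Γᵀ ∩ ℝ^n_{≥0} \ {0} ≠ ∅`, then at most `1`. -/
theorem statement18 {n m pf : ℕ}
    (Γ : Matrix (Fin n) (Fin m) ℤ) (A : Matrix (Fin m) (Fin n) ℤ)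
    (hA : ∀ i j, 0 ≤ A i j) (hquad : ∀ i, ∑ j, A i j ≤ 2)
    (hdyn : dynNontrivial Γ)
    (hrank : (mR Γ).rank + 1 = n)
    (blk : Fin m → Fin pf) (hblk : Function.Surjective blk) (hfac : factorsOver Γ blk)
    (hfund : ∀ (p' : ℕ) (blk' : Fin m → Fin p'), Function.Surjective blk' →
      factorsOver Γ blk' → ∀ j k, blk j = blk k → blk' j = blk' k)
    (hm1 : n ≤ m) (hm2 : m + 1 ≤ n + pf)
    (z : Fin n → ℝ) (hz : Matrix.vecMul z (mR Γ) = 0) (hz0 : z ≠ 0) :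
    ((Matrix.of fun i : Fin m => Fin.snoc (fun j => (A i j : ℝ)) 1 :
        Matrix (Fin m) (Fin (n + 1)) ℝ).rank ≤ n →
      ∀ κ ∈ posOrth m, ∀ K : ℝ, ∀ T : Finset (Fin n → ℝ),
        ↑T ⊆ {x | x ∈ Eset Γ A κ ∧ z ⬝ᵥ x = K ∧ nondegAt Γ A κ x} → T.card ≤ 2) ∧
    ((∃ zz : Fin n → ℝ, (mR A).mulVec zz = fun _ => 1) →
      (∃ ω : Fin n → ℝ, Matrix.vecMul ω (mR Γ) = 0 ∧ (∀ i, 0 ≤ ω i) ∧ ω ≠ 0) →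
      ∀ κ ∈ posOrth m, ∀ K : ℝ, ∀ T : Finset (Fin n → ℝ),
        ↑T ⊆ {x | x ∈ Eset Γ A κ ∧ z ⬝ᵥ x = K ∧ nondegAt Γ A κ x} → T.card ≤ 1) := by
  have hn : 0 < n := by omega
  constructor
  · intro hsrc κ hκ K T hT
    by_contra hcard
    obtain ⟨x, hx, y, hy, y', hy', hxy, hxy', hyy'⟩ := Finset.two_lt_card.1 (not_le.1 hcard)
    obtain ⟨hxE, hxK, hxN⟩ := hT hx
    obtain ⟨hyE, hyK, -⟩ := hT hy
    obtain ⟨hyE', hyK', -⟩ := hT hy'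
    obtain ⟨w, c, hw0, hw⟩ := aux_srcker (by omega) A hsrc
    obtain ⟨s, hsc, hs⟩ := aux_vals Γ A hA hquad hrank hm1 blk hfac z hz hz0 κ x hxE hxN w c
      hw0 hw
    obtain ⟨a, b, ha, hb, hab⟩ := aux_ab w hw0 c s hsc hs
    obtain ⟨t, rfl⟩ := aux_curve Γ A hdyn hrank blk hblk hfac hm2 z hz hz0 κ hκ x hxE hxN w c
      hw0 hw y hyE
    obtain ⟨r, rfl⟩ := aux_curve Γ A hdyn hrank blk hblk hfac hm2 z hz hz0 κ hκ x hxE hxN w c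
      hw0 hw y' hyE'
    have hsum := aux_exp3 (fun j => z j * x j) w a b ha hb hab t r
      (by rintro rfl; simp at hxy) (by rintro rfl; simp at hxy')
      (by rintro rfl; simp at hyy')
      (by simpa only [dotProduct, mul_assoc] using hyK.trans hxK.symm)
      (by simpa only [dotProduct, mul_assoc] using hyK'.trans hxK.symm)
    refine hw0 (aux_trans Γ A hrank blk hfac z hz hz0 κ x hxE hxN w (fun _ => c) hw ?_)
    simpa only [dotProduct, mul_assoc, Pi.mul_apply] using hsum
  · rintro ⟨w, hw⟩ ⟨ω, hω, hωp, hω0⟩ κ hκ K T hT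
    have hw0 : w ≠ 0 := by
      rintro rfl
      have := congrFun hw ⟨0, by omega⟩
      simp at this
    -- along the curve, the conserved quantity is monotone
    have key : ∀ (x : Fin n → ℝ), x ∈ Eset Γ A κ → nondegAt Γ A κ x → ∀ t : ℝ, 0 < t →
        z ⬝ᵥ (fun j => x j * Real.exp (t * w j)) = z ⬝ᵥ x → False := by
      intro x hxE hxN t ht hK
      obtain ⟨s, hsc, hs⟩ := aux_vals Γ A hA hquad hrank hm1 blk hfac z hz hz0 κ x hxE hxN w 1
        hw0 hw
      obtain rfl : s = 0 := by simpa using hsc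
      have hwn : ∀ j, 0 ≤ w j := by
        intro j
        have hj := hs j
        rw [zero_mul] at hj
        rcases mul_eq_zero.1 hj with h | h
        · rcases mul_eq_zero.1 h with h | h <;> linarith
        · linarith
      obtain ⟨v, hv⟩ := aux_im (mR Γ) hrank z hz hz0
        ((fun j => x j * Real.exp (t * w j)) - x) (by rw [dotProduct_sub, hK, sub_self])
      have hωK : ω ⬝ᵥ ((fun j => x j * Real.exp (t * w j)) - x) = 0 := by
        rw [← hv, dotProduct_mulVec, hω, zero_dotProduct]
      have hterm : ∀ j, t * (ω j * (x j * w j)) ≤ ω j * (x j * Real.exp (t * w j) - x j) := by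
        intro j
        have h1 := Real.add_one_le_exp (t * w j)
        have h2 : 0 ≤ ω j * x j := mul_nonneg (hωp j) (hxE.1 j).le
        nlinarith [mul_le_mul_of_nonneg_left h1 h2]
      have hle : t * ∑ j, ω j * (x j * w j) ≤ 0 := by
        rw [Finset.mul_sum, ← hωK]
        exact Finset.sum_le_sum fun j _ => hterm j
      have hge : 0 ≤ ∑ j, ω j * (x j * w j) :=
        Finset.sum_nonneg fun j _ => mul_nonneg (hωp j) (mul_nonneg (hxE.1 j).le (hwn j))
      have h0 : ω ⬝ᵥ (x * w) = 0 := by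
        change ∑ j, ω j * (x j * w j) = 0
        nlinarith
      exact hw0 (aux_trans Γ A hrank blk hfac ω hω hω0 κ x hxE hxN w (fun _ => 1) hw h0)
    rw [Finset.card_le_one]
    intro x hx y hy
    obtain ⟨hxE, hxK, hxN⟩ := hT hx
    obtain ⟨hyE, hyK, hyN⟩ := hT hy
    obtain ⟨t, ht⟩ := aux_curve Γ A hdyn hrank blk hblk hfac hm2 z hz hz0 κ hκ x hxE hxN w 1
      hw0 hw y hyE
    rcases lt_trichotomy t 0 with h | h | h
    · exfalso
      have hxy : x = fun j => y j * Real.exp (-t * w j) := by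
        ext j
        rw [ht, mul_assoc, ← Real.exp_add]
        simp
      exact key y hyE hyN (-t) (by linarith) (by rw [← hxy, hxK, hyK])
    · subst h
      rw [ht]; simp
    · exact (key x hxE hxN t h (by rw [← ht, hxK, hyK])).elim


end
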